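/- arXiv:1810.12671 — 4 statements merged into one kernel-verified Lean document; each statement's English description precedes it below -/
import Mathlib

section
/- For i = 1,…,s let k_i, k'_i ∈ ℕ with k'_i ≥ k_i, and let y_i = Σ_{j≥1} y_{i,j} u_i^{-j} with y_{i,j} ∈ {0,…,u_i−1}. For a tuple κ = (κ_1,…,κ_s) ∈ ℕ^s let v̄_i^{(κ)} ∈ ℕ satisfy v_i·v̄_i^{(κ)} ≡ 1 (mod u_i^{κ_i}), let M_{i,κ} ∈ ℕ satisfy M_{i,κ}·Π_{j≠i} u_j^{κ_j} ≡ 1 (mod u_i^{κ_i}), set U_κ = Π_{i=1}^s u_i^{κ_i}, ẏ_{i,κ_i} = Σ_{j=1}^{κ_i} σ_{i,j}^{-1}(y_{i,j})·u_i^{j−1}·(v̄_i^{(κ)})^j, and ÿ_κ = Σ_{i=1}^s M_{i,κ}·(U_κ/u_i^{κ_i})·ẏ_{i,κ_i}. Then, with k = (k_1,…,k_s) and k' = (k'_1,…,k'_s), one has ÿ_{k'} ≡ ÿ_k (mod U_k). -/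
open Finset

/-- The auxiliary integers `z_r` in the formal `u/v`-adic expansion of an integer `z`:
`z_0 = z` and `z_{r+1} = (v·z_r − a_{r+1})/u`, where `a_{r+1} = (v·z_r) mod u` is the unique
element of `{0,…,u−1}` with `u ∣ (v·z_r − a_{r+1})`. -/
def ratZ (u v : ℕ) (z : ℤ) : ℕ → ℤ
  | 0 => z
  | r + 1 => ((v : ℤ) * ratZ u v z r - ((v : ℤ) * ratZ u v z r) % (u : ℤ)) / (u : ℤ)

/-- `ratDigit u v z r` is the digit `a_{r+1}` of the formal `u/v`-adic expansion of `z`,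
i.e. the unique element of `{0,…,u−1}` with `u ∣ (v·z_r − a_{r+1})`. -/
def ratDigit (u v : ℕ) (z : ℤ) (r : ℕ) : ℕ :=
  (((v : ℤ) * ratZ u v z r) % (u : ℤ)).toNat

/-- The generalized `u/v`-adic radical inverse function
`φ^Σ_{u/v}(n) = Σ_{r≥1} σ_r(a_r)/u^r`, where `σ r` is the permutation `σ_{r+1}` of
`{0,…,u−1}` and `a_{r+1} = ratDigit u v n r`. -/
noncomputable def ratPhi (u v : ℕ) (σ : ℕ → ℕ → ℕ) (n : ℕ) : ℝ :=
  ∑' r : ℕ, (σ r (ratDigit u v (n : ℤ) r) : ℝ) / (u : ℝ) ^ (r + 1)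

/-- The truncation `[φ^Σ_{u/v}(n)]_t = Σ_{r=1}^t σ_r(a_r)/u^r` of the generalized
`u/v`-adic radical inverse function to its first `t` prescribed digits. -/
noncomputable def ratPhiTrunc (u v : ℕ) (σ : ℕ → ℕ → ℕ) (t n : ℕ) : ℝ :=
  ∑ r ∈ Finset.range t, (σ r (ratDigit u v (n : ℤ) r) : ℝ) / (u : ℝ) ^ (r + 1)

/-- The star discrepancy `D*_N` of the first `N` points of the sequence `x` in `[0,1]^s`:
`D*_N = sup_{y ∈ (0,1]^s} |#{0 ≤ n < N : x_n^{(i)} < y^{(i)}, i=1,…,s}/N − Π_i y^{(i)}|`. -/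
noncomputable def starDisc (s N : ℕ) (x : ℕ → Fin s → ℝ) : ℝ :=
  sSup { d : ℝ | ∃ y : Fin s → ℝ, (∀ i, y i ∈ Set.Ioc (0 : ℝ) 1) ∧
    d = |(Nat.card {n : ℕ | n < N ∧ ∀ i, x n i < y i} : ℝ) / N - ∏ i, y i| }

/-- The interpolation sum of the Chinese remainder theorem solves each congruence. -/
theorem sum_mul_prod_erase_modEq {ι : Type*} [Fintype ι] [DecidableEq ι] (m M Y : ι → ℕ) (i : ι)
    (hM : M i * ∏ j ∈ univ.erase i, m j ≡ 1 [MOD m i]) :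
    ∑ l, M l * (∏ j ∈ univ.erase l, m j) * Y l ≡ Y i [MOD m i] := by
  rw [← add_sum_erase univ _ (mem_univ i)]
  have hrest : ∑ l ∈ univ.erase i, M l * (∏ j ∈ univ.erase l, m j) * Y l ≡ 0 [MOD m i] := by
    refine (Nat.modEq_zero_iff_dvd).2 (dvd_sum fun l hl => ?_)
    have hil : i ∈ univ.erase l := mem_erase.2 ⟨(ne_of_mem_erase hl).symm, mem_univ i⟩
    exact ((dvd_prod_of_mem m hil).mul_left _).mul_right _
  simpa using (hM.mul_right (Y i)).add hrest

/-- Modulo `n ^ k`, an `n`-adic sum may be truncated to its first `k` terms, and its coefficients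
only matter modulo `n ^ k`. -/
theorem sum_range_mul_pow_modEq_of_le {n k l b c : ℕ} (hkl : k ≤ l) (hbc : b ≡ c [MOD n ^ k])
    (a : ℕ → ℕ) :
    ∑ j ∈ range l, a j * n ^ j * b ^ (j + 1) ≡
      ∑ j ∈ range k, a j * n ^ j * c ^ (j + 1) [MOD n ^ k] := by
  rw [← sum_range_add_sum_Ico _ hkl]
  have htail : ∑ j ∈ Ico k l, a j * n ^ j * b ^ (j + 1) ≡ 0 [MOD n ^ k] :=
    (Nat.modEq_zero_iff_dvd).2 <| dvd_sum fun j hj =>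
      ((pow_dvd_pow n (mem_Ico.1 hj).1).mul_left _).mul_right _
  have hhead : ∑ j ∈ range k, a j * n ^ j * b ^ (j + 1) ≡
      ∑ j ∈ range k, a j * n ^ j * c ^ (j + 1) [MOD n ^ k] :=
    Nat.ModEq.sum fun j _ => (hbc.pow (j + 1)).mul_left _
  simpa using hhead.add htail

/-- Two inverses of `v` modulo `n` are congruent. -/
theorem modEq_of_mul_modEq_one {n v b c : ℕ} (hb : v * b ≡ 1 [MOD n]) (hc : v * c ≡ 1 [MOD n]) :
    b ≡ c [MOD n] :=
  calc b = b * 1 := (mul_one b).symm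
    _ ≡ b * (v * c) [MOD n] := hc.symm.mul_left b
    _ = v * b * c := by ring
    _ ≡ 1 * c [MOD n] := hb.mul_right c
    _ = c := one_mul c

/-- Congruences modulo pairwise coprime numbers combine to one modulo their product. -/
theorem modEq_prod_of_pairwise_coprime {ι : Type*} [Fintype ι] {m : ι → ℕ} {a b : ℕ}
    (hm : Pairwise fun i j => Nat.Coprime (m i) (m j)) (h : ∀ i, a ≡ b [MOD m i]) :
    a ≡ b [MOD ∏ i, m i] := by
  rw [Nat.modEq_iff_dvd, Nat.cast_prod]
  exact Fintype.prod_dvd_of_coprime (fun i j hij => (hm hij).isCoprime)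
    fun i => (Nat.modEq_iff_dvd).1 (h i)

/-- **Lemma 2, item 5.** If `k'_i ≥ k_i` for all `i`, then `ÿ_{k'} ≡ ÿ_k (mod U_k)`, where
for a tuple `κ`, `ÿ_κ = Σ_i M_{i,κ}·(U_κ/u_i^{κ_i})·Σ_{j=1}^{κ_i} σ_{i,j}^{-1}(y_{i,j})·u_i^{j−1}·(v̄_i^{(κ)})^j`. -/
theorem halton_yddot_modEq_of_le
    (s : ℕ) (hs : 1 ≤ s) (u v : Fin s → ℕ)
    (hu : ∀ i, 2 ≤ u i) (hv : ∀ i, 1 ≤ v i)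
    (huv : ∀ i, Nat.Coprime (u i) (v i))
    (hcop : ∀ i j, i ≠ j → Nat.Coprime (u i) (u j))
    (σ σinv : Fin s → ℕ → ℕ → ℕ)
    (hσ : ∀ i r, Set.BijOn (σ i r) (Set.Iio (u i)) (Set.Iio (u i)))
    (hinv : ∀ i r, Set.InvOn (σinv i r) (σ i r) (Set.Iio (u i)) (Set.Iio (u i)))
    (hinvmap : ∀ i r, Set.MapsTo (σinv i r) (Set.Iio (u i)) (Set.Iio (u i)))
    (k k' : Fin s → ℕ) (hk : ∀ i, 1 ≤ k i) (hkk' : ∀ i, k i ≤ k' i)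
    (y : Fin s → ℕ → ℕ) (hy : ∀ i j, y i j < u i)
    (vbarK vbarK' : Fin s → ℕ)
    (hvbarK : ∀ i, v i * vbarK i ≡ 1 [MOD u i ^ k i])
    (hvbarK' : ∀ i, v i * vbarK' i ≡ 1 [MOD u i ^ k' i])
    (MK MK' : Fin s → ℕ)
    (hMK : ∀ i, MK i * ∏ j ∈ Finset.univ.erase i, u j ^ k j ≡ 1 [MOD u i ^ k i])
    (hMK' : ∀ i, MK' i * ∏ j ∈ Finset.univ.erase i, u j ^ k' j ≡ 1 [MOD u i ^ k' i]) :
    (∑ i, MK' i * (∏ j ∈ Finset.univ.erase i, u j ^ k' j) *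
        (∑ j ∈ Finset.range (k' i), σinv i j (y i j) * u i ^ j * vbarK' i ^ (j + 1))) ≡
      (∑ i, MK i * (∏ j ∈ Finset.univ.erase i, u j ^ k j) *
        (∑ j ∈ Finset.range (k i), σinv i j (y i j) * u i ^ j * vbarK i ^ (j + 1)))
      [MOD ∏ i, u i ^ k i] := by
  refine modEq_prod_of_pairwise_coprime
    (fun i j hij => Nat.Coprime.pow _ _ (hcop i j hij)) fun i => ?_
  have hdvd : u i ^ k i ∣ u i ^ k' i := pow_dvd_pow _ (hkk' i)
  have hsum := sum_range_mul_pow_modEq_of_le (hkk' i)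
    (modEq_of_mul_modEq_one ((hvbarK' i).of_dvd hdvd) (hvbarK i)) fun j => σinv i j (y i j)
  have hcrt := sum_mul_prod_erase_modEq (fun j => u j ^ k j) MK
    (fun l => ∑ j ∈ range (k l), σinv l j (y l j) * u l ^ j * vbarK l ^ (j + 1)) i (hMK i)
  have hcrt' := sum_mul_prod_erase_modEq (fun j => u j ^ k' j) MK'
    (fun l => ∑ j ∈ range (k' l), σinv l j (y l j) * u l ^ j * vbarK' l ^ (j + 1)) i (hMK' i)
  exact (hcrt'.of_dvd hdvd).trans (hsum.trans hcrt.symm)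
end

section
/- Let s > 1 and let u_1,…,u_s, v_1,…,v_s ∈ ℕ satisfy u_i ≥ 2, gcd(u_i,v_i) = 1 for 1 ≤ i ≤ s, and gcd(u_i,u_j) = 1 for 1 ≤ i ≠ j ≤ s. For each i let v̄_i ∈ ℕ be such that v̄_i·v_i ≡ 1 (mod u_i), let τ_i ∈ ℕ be such that v_i^{τ_i} ≡ 1 (mod u_i), and let b_i ∈ {1,…,u_i−1}. Then Σ_{i=1}^s b_i·v̄_i^{τ_i}/u_i ≢ 1/2 (mod 1), i.e., Σ_{i=1}^s b_i·v̄_i^{τ_i}/u_i − 1/2 is not an integer. -/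
open Finset

/-- A common denominator of a finite sum of fractions is the product of the denominators. -/
theorem exists_nat_eq_prod_mul_sum_div {ι : Type*} (S : Finset ι) (c u : ι → ℕ)
    (hu : ∀ i ∈ S, u i ≠ 0) :
    ∃ q : ℕ, ((∏ i ∈ S, u i : ℕ) : ℝ) * ∑ i ∈ S, (c i : ℝ) / (u i : ℝ) = q := by
  classical
  refine ⟨∑ i ∈ S, c i * ∏ j ∈ S.erase i, u j, ?_⟩
  rw [Finset.mul_sum, Nat.cast_sum]
  refine Finset.sum_congr rfl fun i hi => ?_
  have hi0 : (u i : ℝ) ≠ 0 := Nat.cast_ne_zero.mpr (hu i hi)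
  rw [← Finset.mul_prod_erase S u hi, Nat.cast_mul, Nat.cast_mul]
  field_simp

/-- If a sum of fractions with pairwise coprime denominators is congruent to `1/2` modulo `1`,
then every odd denominator divides its numerator. -/
theorem dvd_of_sum_div_sub_half_eq_int {ι : Type*} [Fintype ι] (c u : ι → ℕ)
    (hu : ∀ i, u i ≠ 0) (hcop : ∀ i j, i ≠ j → Nat.Coprime (u i) (u j)) (z : ℤ)
    (hz : (∑ i, (c i : ℝ) / (u i : ℝ)) - 1 / 2 = z) (i : ι) (hi : Odd (u i)) :
    u i ∣ c i := by
  classical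
  obtain ⟨q, hq⟩ := exists_nat_eq_prod_mul_sum_div (univ.erase i) c u fun j _ => hu j
  set P := ∏ j ∈ univ.erase i, u j
  have hPcop : Nat.Coprime (u i) (P * 2) :=
    (Nat.Coprime.prod_right fun j hj => hcop i j (Finset.ne_of_mem_erase hj).symm).mul_right
      hi.coprime_two_right
  have hi0 : (u i : ℝ) ≠ 0 := Nat.cast_ne_zero.mpr (hu i)
  rw [← Finset.add_sum_erase univ _ (Finset.mem_univ i)] at hz
  have key : ((P * 2 * c i : ℕ) : ℤ) = u i * (2 * P * z + P - 2 * q) := by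
    have hreal : (P : ℝ) * 2 * c i = u i * (2 * P * z + P - 2 * q) := by
      rw [← hz, ← hq]
      field_simp
      ring
    exact_mod_cast hreal
  exact hPcop.dvd_of_dvd_mul_left (Int.natCast_dvd_natCast.mp ⟨_, key⟩)

/-- **Lemma 3.** For `s > 1`, pairwise coprime `u_i ≥ 2`, `gcd(u_i,v_i) = 1`,
`v̄_i·v_i ≡ 1 (mod u_i)`, `v_i^{τ_i} ≡ 1 (mod u_i)` and `b_i ∈ {1,…,u_i−1}`:
`Σ_{i=1}^s b_i·v̄_i^{τ_i}/u_i ≢ 1/2 (mod 1)`. -/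
theorem sum_b_vbar_pow_div_u_not_half_mod_one
    (s : ℕ) (hs : 1 < s) (u v vbar τ b : Fin s → ℕ)
    (hu : ∀ i, 2 ≤ u i) (hv : ∀ i, 1 ≤ v i) (hvbar1 : ∀ i, 1 ≤ vbar i)
    (hτ : ∀ i, 1 ≤ τ i)
    (huv : ∀ i, Nat.Coprime (u i) (v i))
    (hcop : ∀ i j, i ≠ j → Nat.Coprime (u i) (u j))
    (hvbar : ∀ i, vbar i * v i ≡ 1 [MOD u i])
    (hτv : ∀ i, v i ^ τ i ≡ 1 [MOD u i])
    (hb1 : ∀ i, 1 ≤ b i) (hb2 : ∀ i, b i ≤ u i - 1) :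
    ¬ ∃ z : ℤ, (∑ i, (b i : ℝ) * (vbar i : ℝ) ^ τ i / (u i : ℝ)) - 1 / 2 = (z : ℝ) := by
  rintro ⟨z, hz⟩
  obtain ⟨i, hi⟩ : ∃ i, Odd (u i) := by
    by_contra! h
    have h2 : ∀ i, 2 ∣ u i := fun i => (Nat.not_odd_iff_even.mp (h i)).two_dvd
    have h01 := hcop ⟨0, by omega⟩ ⟨1, hs⟩ (by simp)
    exact Nat.not_coprime_of_dvd_of_dvd one_lt_two (h2 _) (h2 _) h01
  have hdvd : u i ∣ b i * vbar i ^ τ i := by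
    refine dvd_of_sum_div_sub_half_eq_int (fun i => b i * vbar i ^ τ i) u
      (fun j => by have := hu j; omega) hcop z ?_ i hi
    push_cast
    exact hz
  have hcopv : Nat.Coprime (u i) (vbar i) :=
    (Nat.coprime_of_mul_modEq_one (v i) (hvbar i)).symm
  have hle := Nat.le_of_dvd (hb1 i) ((hcopv.pow_right (τ i)).dvd_of_dvd_mul_right hdvd)
  have := hb2 i
  have := hu i
  omega
end

section
/- Let s ≥ 2 and let ū_1,…,ū_s be pairwise coprime integers with ū_i ≥ 2 for all i, and let b̄_1,…,b̄_s be integers with gcd(b̄_i, ū_i) = 1 for all i. Then Σ_{i=1}^s b̄_i/ū_i ≢ 1/2 (mod 1), i.e., Σ_{i=1}^s b̄_i/ū_i − 1/2 is not an integer. -/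
open Finset

/-- If `m · Σ b_i/u_i` is an integer for reduced fractions with pairwise coprime denominators,
then every denominator divides `m`. -/
theorem dvd_of_mul_sum_div_eq_intCast {ι : Type*} [DecidableEq ι] (t : Finset ι) (u b : ι → ℤ)
    (hu : ∀ i ∈ t, u i ≠ 0) (hcop : (t : Set ι).Pairwise fun i j => IsCoprime (u i) (u j))
    {m n : ℤ} (h : (m : ℝ) * ∑ i ∈ t, (b i : ℝ) / (u i : ℝ) = n)
    {j : ι} (hj : j ∈ t) (hb : IsCoprime (b j) (u j)) : u j ∣ m := by
  have hQ : IsCoprime (u j) (∏ k ∈ t.erase j, u k) :=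
    IsCoprime.prod_right fun k hk =>
      hcop hj (Finset.mem_of_mem_erase hk) (Finset.ne_of_mem_erase hk).symm
  have hrest : (∏ k ∈ t.erase j, (u k : ℝ)) * ∑ i ∈ t.erase j, (b i : ℝ) / (u i : ℝ) =
      ((∑ i ∈ t.erase j, b i * ∏ k ∈ (t.erase j).erase i, u k : ℤ) : ℝ) := by
    push_cast
    rw [Finset.mul_sum]
    refine Finset.sum_congr rfl fun i hi => ?_
    have hi0 : (u i : ℝ) ≠ 0 := Int.cast_ne_zero.mpr (hu i (Finset.mem_of_mem_erase hi))
    rw [← Finset.mul_prod_erase _ _ hi]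
    field_simp
  have hj0 : (u j : ℝ) ≠ 0 := Int.cast_ne_zero.mpr (hu j hj)
  set Q := ∏ k ∈ t.erase j, u k with hQdef
  set W := ∑ i ∈ t.erase j, b i * ∏ k ∈ (t.erase j).erase i, u k
  rw [← Int.cast_prod, ← hQdef] at hrest
  rw [← Finset.add_sum_erase _ _ hj] at h
  have key : m * (b j * Q) = u j * (n * Q - m * W) := by
    have : (m : ℝ) * (b j * Q) = u j * (n * Q - m * W) := by
      rw [← hrest, ← h]
      field_simp
      ring
    exact_mod_cast this
  exact (hb.symm.mul_right hQ).dvd_of_dvd_mul_right ⟨_, key⟩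

/-- For `s ≥ 2`, pairwise coprime integers `ū_i ≥ 2` and integers `b̄_i` with
`gcd(b̄_i, ū_i) = 1`: `Σ_{i=1}^s b̄_i/ū_i ≢ 1/2 (mod 1)`. -/
theorem sum_coprime_fractions_not_half_mod_one
    (s : ℕ) (hs : 2 ≤ s) (ubar bbar : Fin s → ℤ)
    (hu : ∀ i, 2 ≤ ubar i)
    (hcop : ∀ i j, i ≠ j → IsCoprime (ubar i) (ubar j))
    (hb : ∀ i, IsCoprime (bbar i) (ubar i)) :
    ¬ ∃ z : ℤ, (∑ i, (bbar i : ℝ) / (ubar i : ℝ)) - 1 / 2 = (z : ℝ) := by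
  rintro ⟨z, hz⟩
  have hsum : ((2 : ℤ) : ℝ) * ∑ i, (bbar i : ℝ) / (ubar i : ℝ) = ((2 * z + 1 : ℤ) : ℝ) := by
    push_cast
    linarith
  have htwo : ∀ j, ubar j = 2 := fun j =>
    le_antisymm (Int.le_of_dvd two_pos <|
      dvd_of_mul_sum_div_eq_intCast Finset.univ ubar bbar
        (fun i _ => (two_pos.trans_le (hu i)).ne') (fun i _ k _ hik => hcop i k hik)
        hsum (Finset.mem_univ j) (hb j)) (hu j)
  have h := hcop ⟨0, by omega⟩ ⟨1, by omega⟩ (by simp)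
  rw [htwo, htwo, isCoprime_self, Int.isUnit_iff] at h
  omega
end

section
/- For i = 1,…,s let k_i ∈ ℕ, let t ∈ ℕ with t ≥ k_i for all i, and let w_i = Σ_{j=1}^{k_i} w_{i,j} u_i^{-j} with w_{i,j} ∈ {0,…,u_i−1}. Set U = Π_{i=1}^s u_i^{k_i}. Then for every integer L ≥ 0 there is exactly one integer n with L ≤ n < L + U such that [φ^{Σ_i}_{u_i/v_i}(n)]_t ∈ [w_i, w_i + 1/u_i^{k_i}) for all i = 1,…,s. -/
open Finset

theorem ratZ_succ' (u v : ℕ) (z : ℤ) (r : ℕ) :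
    ratZ u v z (r + 1) = ratZ u v (ratZ u v z 1) r := by
  induction r with
  | zero => rfl
  | succ r ih =>
    rw [ratZ, ih]
    rfl

theorem ratDigit_succ (u v : ℕ) (z : ℤ) (r : ℕ) :
    ratDigit u v z (r + 1) = ratDigit u v (ratZ u v z 1) r := by
  rw [ratDigit, ratZ_succ', ratDigit]

theorem natCast_ratDigit {u : ℕ} (hu : 0 < u) (v : ℕ) (z : ℤ) (r : ℕ) :
    (ratDigit u v z r : ℤ) = (v * ratZ u v z r) % u :=
  Int.toNat_of_nonneg (Int.emod_nonneg _ (by omega))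

theorem ratDigit_lt {u : ℕ} (hu : 0 < u) (v : ℕ) (z : ℤ) (r : ℕ) :
    ratDigit u v z r < u := by
  have h := Int.emod_lt_of_pos ((v : ℤ) * ratZ u v z r) (Int.natCast_pos.mpr hu)
  rw [← natCast_ratDigit hu] at h
  exact_mod_cast h

theorem mul_ratZ_one {u : ℕ} (hu : 0 < u) (v : ℕ) (z : ℤ) :
    (u : ℤ) * ratZ u v z 1 = v * z - ratDigit u v z 0 := by
  rw [natCast_ratDigit hu, ratZ, ratZ]
  exact Int.mul_ediv_cancel' (Int.dvd_self_sub_emod)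

/-- The first `k` digits determine, and are determined by, the residue class modulo `u ^ k`. -/
theorem forall_ratDigit_eq_iff {u v : ℕ} (hu : 0 < u) (huv : Nat.Coprime u v) (k : ℕ)
    (z z' : ℤ) :
    (∀ r < k, ratDigit u v z r = ratDigit u v z' r) ↔ (u : ℤ) ^ k ∣ z - z' := by
  induction k generalizing z z' with
  | zero => simp
  | succ k ih =>
    have hu0 : (u : ℤ) ≠ 0 := by omega
    have hcop : IsCoprime ((u : ℤ) ^ (k + 1)) v :=
      (Nat.isCoprime_iff_coprime.mpr huv).pow_left
    have key : ratDigit u v z 0 = ratDigit u v z' 0 →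
        ((u : ℤ) ^ k ∣ ratZ u v z 1 - ratZ u v z' 1 ↔ (u : ℤ) ^ (k + 1) ∣ z - z') := by
      intro h0
      have hz := mul_ratZ_one hu v z
      have hz' := mul_ratZ_one hu v z'
      rw [h0] at hz
      have e : (u : ℤ) * (ratZ u v z 1 - ratZ u v z' 1) = v * (z - z') := by
        linear_combination hz - hz'
      rw [← mul_dvd_mul_iff_left hu0, e, ← pow_succ']
      exact ⟨hcop.dvd_of_dvd_mul_left, fun h => h.mul_left _⟩
    rw [Nat.forall_lt_succ_left]
    simp only [ratDigit_succ]
    rw [ih]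
    refine ⟨fun h => (key h.1).1 h.2, fun h => ?_⟩
    have h0 : ratDigit u v z 0 = ratDigit u v z' 0 := by
      have hd : (u : ℤ) ∣ v * z - v * z' := by
        rw [← mul_sub]
        exact ((dvd_pow_self _ k.succ_ne_zero).trans h).mul_left _
      have he : (v * z) % (u : ℤ) = (v * z') % u := Int.emod_eq_emod_iff_emod_sub_eq_zero.mpr
        (Int.emod_eq_zero_of_dvd hd)
      simp only [ratDigit, ratZ, he]
    exact ⟨h0, (key h0).2 h⟩

theorem exists_forall_ratDigit_eq {u v : ℕ} (hu : 0 < u) (huv : Nat.Coprime u v) (k : ℕ)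
    (a : ℕ → ℕ) (ha : ∀ r < k, a r < u) :
    ∃ z : ℤ, ∀ r < k, ratDigit u v z r = a r := by
  induction k generalizing a with
  | zero => simp
  | succ k ih =>
    obtain ⟨y, hy⟩ := ih (fun r => a (r + 1)) (fun r hr => ha _ (by omega))
    obtain ⟨p, q, hpq⟩ : IsCoprime ((u : ℤ) ^ (k + 1)) v :=
      (Nat.isCoprime_iff_coprime.mpr huv).pow_left
    set c : ℤ := u * y + a 0 with hc
    have hvz : (v : ℤ) * (q * c) = a 0 + u * (y - u ^ k * p * c) := by
      linear_combination c * hpq + hc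
    have h0 : ratDigit u v (q * c) 0 = a 0 := by
      have h := natCast_ratDigit hu v (q * c) 0
      rw [ratZ, hvz, Int.add_mul_emod_self_left,
        Int.emod_eq_of_lt (by omega) (by exact_mod_cast ha 0 k.succ_pos)] at h
      exact_mod_cast h
    have h1 : ratZ u v (q * c) 1 = y - u ^ k * p * c := by
      have h := mul_ratZ_one hu v (q * c)
      rw [hvz, h0, add_sub_cancel_left] at h
      exact mul_left_cancel₀ (by omega) h
    refine ⟨q * c, Nat.forall_lt_succ_left.mpr ⟨h0, fun r hr => ?_⟩⟩
    rw [ratDigit_succ, ← hy r hr]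
    refine (forall_ratDigit_eq_iff hu huv k _ _).2 ?_ r hr
    rw [h1]
    exact ⟨-(p * c), by ring⟩

theorem sum_range_succ_div_pow (u : ℝ) (d : ℕ → ℕ) (t : ℕ) :
    ∑ r ∈ range (t + 1), (d r : ℝ) / u ^ (r + 1) =
      (d 0 + ∑ r ∈ range t, (d (r + 1) : ℝ) / u ^ (r + 1)) / u := by
  rw [sum_range_succ', add_div, sum_div, add_comm]
  congr 1
  · simp
  · exact sum_congr rfl fun r _ => by rw [div_div, ← pow_succ]

theorem sum_digits_div_pow_add_le_one {u : ℕ} (hu : 0 < u) (d : ℕ → ℕ) (t : ℕ)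
    (hd : ∀ r < t, d r < u) :
    ∑ r ∈ range t, (d r : ℝ) / (u : ℝ) ^ (r + 1) + 1 / (u : ℝ) ^ t ≤ 1 := by
  induction t generalizing d with
  | zero => simp
  | succ t ih =>
    have hu' : (0 : ℝ) < u := by exact_mod_cast hu
    have h := ih (fun r => d (r + 1)) (fun r hr => hd _ (by omega))
    have h0 : (d 0 : ℝ) + 1 ≤ u := by exact_mod_cast hd 0 t.succ_pos
    rw [sum_range_succ_div_pow, pow_succ, ← div_div, ← add_div, div_le_one hu']
    linarith

/-- A finite base-`u` expansion lies in an elementary interval iff its leading digits are those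
of the left endpoint. -/
theorem sum_digits_mem_Ico_iff {u : ℕ} (hu : 0 < u) {k t : ℕ} (hkt : k ≤ t) (d w : ℕ → ℕ)
    (hd : ∀ r < t, d r < u) (hw : ∀ r < k, w r < u) :
    ∑ r ∈ range t, (d r : ℝ) / (u : ℝ) ^ (r + 1) ∈
        Set.Ico (∑ r ∈ range k, (w r : ℝ) / (u : ℝ) ^ (r + 1))
          (∑ r ∈ range k, (w r : ℝ) / (u : ℝ) ^ (r + 1) + 1 / (u : ℝ) ^ k) ↔
      ∀ r < k, d r = w r := by
  have hu' : (0 : ℝ) < u := by exact_mod_cast hu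
  have nonneg : ∀ (e : ℕ → ℕ) (m : ℕ), 0 ≤ ∑ r ∈ range m, (e r : ℝ) / (u : ℝ) ^ (r + 1) :=
    fun e m => sum_nonneg fun r _ => by positivity
  have lt_one : ∀ (e : ℕ → ℕ) (m : ℕ), (∀ r < m, e r < u) →
      ∑ r ∈ range m, (e r : ℝ) / (u : ℝ) ^ (r + 1) < 1 := fun e m he => by
    have h := sum_digits_div_pow_add_le_one hu e m he
    have : 0 < 1 / (u : ℝ) ^ m := by positivity
    linarith
  induction k generalizing d w t with
  | zero => simpa using ⟨nonneg d t, lt_one d t hd⟩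
  | succ k ih =>
    obtain ⟨t, rfl⟩ : ∃ m, t = m + 1 := ⟨t - 1, by omega⟩
    have hd' : ∀ r < t, d (r + 1) < u := fun r hr => hd _ (by omega)
    have hw' : ∀ r < k, w (r + 1) < u := fun r hr => hw _ (by omega)
    have hkt' : k ≤ t := by omega
    have ih' := ih hkt' (fun r => d (r + 1)) (fun r => w (r + 1)) hd' hw'
    rw [Nat.forall_lt_succ_left]
    refine Iff.trans ?_ (and_congr_right' ih')
    rw [sum_range_succ_div_pow, sum_range_succ_div_pow, pow_succ, ← div_div, ← add_div,
      Set.mem_Ico, Set.mem_Ico, div_le_div_iff_of_pos_right hu', div_lt_div_iff_of_pos_right hu']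
    have d0 := nonneg (fun r => d (r + 1)) t
    have d1 := lt_one (fun r => d (r + 1)) t hd'
    have w0 := nonneg (fun r => w (r + 1)) k
    have w1 := sum_digits_div_pow_add_le_one hu (fun r => w (r + 1)) k hw'
    constructor
    · rintro ⟨h1, h2⟩
      have a : (w 0 : ℝ) < d 0 + 1 := by linarith
      have b : (d 0 : ℝ) < w 0 + 1 := by linarith
      norm_cast at a b
      have e : d 0 = w 0 := by omega
      rw [e] at h1 h2
      exact ⟨e, by linarith, by linarith⟩
    · rintro ⟨e, h1, h2⟩
      rw [e]
      constructor <;> linarith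

theorem existsUnique_mem_block_dvd_sub (L U : ℕ) (hU : 0 < U) (x : ℤ) :
    ∃! n : ℕ, (L ≤ n ∧ n < L + U) ∧ (U : ℤ) ∣ n - x := by
  have hU' : (0 : ℤ) < U := by exact_mod_cast hU
  have h0 := Int.emod_nonneg (x - L) hU'.ne'
  have h1 := Int.emod_lt_of_pos (x - L) hU'
  have h2 := Int.emod_add_mul_ediv (x - L) U
  refine ⟨L + ((x - L) % U).toNat, ⟨⟨by omega, by omega⟩, -((x - L) / U), ?_⟩, ?_⟩
  · push_cast
    rw [Int.toNat_of_nonneg h0]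
    linear_combination h2
  · rintro n ⟨⟨hL, hn⟩, c, hc⟩
    have h : (x - L) % U = n - L := by
      rw [show x - L = (n - L : ℤ) + U * -c by linear_combination -hc,
        Int.add_mul_emod_self_left, Int.emod_eq_of_lt (by omega) (by omega)]
    omega

theorem exists_forall_dvd_sub_of_pairwise_isCoprime {ι : Type*} [Fintype ι] (m x : ι → ℤ)
    (hm : Pairwise (Function.onFun IsCoprime m)) :
    ∃ y : ℤ, ∀ i, m i ∣ y - x i := by
  obtain ⟨y, hy⟩ := Ideal.exists_forall_sub_mem_ideal
    (I := fun i => Ideal.span {m i})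
    (fun i j hij => (Ideal.isCoprime_span_singleton_iff _ _).2 (hm hij)) x
  exact ⟨y, fun i => Ideal.mem_span_singleton.1 (hy i)⟩

/-- Regularity of the truncated generalized Halton sequence in rational bases: in every
block of `U = Π_i u_i^{k_i}` consecutive indices `L ≤ n < L + U` there is exactly one `n`
with `[φ^{Σ_i}_{u_i/v_i}(n)]_t ∈ [w_i, w_i + 1/u_i^{k_i})` for all `i = 1,…,s`. -/
theorem halton_ratPhiTrunc_existsUnique_in_block
    (s : ℕ) (hs : 1 ≤ s) (u v : Fin s → ℕ)
    (hu : ∀ i, 2 ≤ u i) (hv : ∀ i, 1 ≤ v i)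
    (huv : ∀ i, Nat.Coprime (u i) (v i))
    (hcop : ∀ i j, i ≠ j → Nat.Coprime (u i) (u j))
    (σ : Fin s → ℕ → ℕ → ℕ)
    (hσ : ∀ i r, Set.BijOn (σ i r) (Set.Iio (u i)) (Set.Iio (u i)))
    (k : Fin s → ℕ) (hk : ∀ i, 1 ≤ k i) (t : ℕ) (hkt : ∀ i, k i ≤ t)
    (w : Fin s → ℕ → ℕ) (hw : ∀ i, ∀ j < k i, w i j < u i)
    (L : ℕ) :
    ∃! n : ℕ, (L ≤ n ∧ n < L + ∏ i, u i ^ k i) ∧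
      ∀ i, ratPhiTrunc (u i) (v i) (σ i) t n ∈
        Set.Ico (∑ j ∈ Finset.range (k i), (w i j : ℝ) / (u i : ℝ) ^ (j + 1))
          ((∑ j ∈ Finset.range (k i), (w i j : ℝ) / (u i : ℝ) ^ (j + 1)) +
            1 / (u i : ℝ) ^ k i) := by
  have hpos : ∀ i, 0 < u i := fun i => by have := hu i; omega
  have digits : ∀ i, ∃ z : ℤ, ∀ r < k i, σ i r (ratDigit (u i) (v i) z r) = w i r := by
    intro i
    choose! a ha using fun r (hr : r < k i) => (hσ i r).surjOn (hw i r hr)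
    obtain ⟨z, hz⟩ := exists_forall_ratDigit_eq (hpos i) (huv i) (k i) a fun r hr => (ha r hr).1
    exact ⟨z, fun r hr => by rw [hz r hr, (ha r hr).2]⟩
  choose z hz using digits
  have hm : Pairwise (Function.onFun IsCoprime fun i => (u i : ℤ) ^ k i) := fun i j hij =>
    (Nat.isCoprime_iff_coprime.mpr (hcop i j hij)).pow
  obtain ⟨x, hx⟩ := exists_forall_dvd_sub_of_pairwise_isCoprime _ z hm
  have hmem : ∀ n : ℕ, (∀ i, ratPhiTrunc (u i) (v i) (σ i) t n ∈
        Set.Ico (∑ j ∈ Finset.range (k i), (w i j : ℝ) / (u i : ℝ) ^ (j + 1))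
          ((∑ j ∈ Finset.range (k i), (w i j : ℝ) / (u i : ℝ) ^ (j + 1)) +
            1 / (u i : ℝ) ^ k i)) ↔ ((∏ i, u i ^ k i : ℕ) : ℤ) ∣ n - x := by
    intro n
    have hi : ∀ i, ratPhiTrunc (u i) (v i) (σ i) t n ∈
        Set.Ico (∑ j ∈ Finset.range (k i), (w i j : ℝ) / (u i : ℝ) ^ (j + 1))
          ((∑ j ∈ Finset.range (k i), (w i j : ℝ) / (u i : ℝ) ^ (j + 1)) +
            1 / (u i : ℝ) ^ k i) ↔ (u i : ℤ) ^ k i ∣ n - x := by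
      intro i
      rw [ratPhiTrunc, sum_digits_mem_Ico_iff (hpos i) (hkt i)
        (fun r => σ i r (ratDigit (u i) (v i) n r)) (w i)
        (fun r _ => (hσ i r).mapsTo (ratDigit_lt (hpos i) _ _ _)) (hw i),
        ← dvd_add_left (hx i), sub_add_sub_cancel, ← forall_ratDigit_eq_iff (hpos i) (huv i)]
      refine forall₂_congr fun r hr => ?_
      rw [← hz i r hr]
      exact (hσ i r).injOn.eq_iff (ratDigit_lt (hpos i) _ _ _) (ratDigit_lt (hpos i) _ _ _)
    simp only [hi]
    push_cast
    exact ⟨fun h => Fintype.prod_dvd_of_coprime hm h,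
      fun h i => (dvd_prod_of_mem (fun i => (u i : ℤ) ^ k i) (mem_univ i)).trans h⟩
  simp only [hmem]
  exact existsUnique_mem_block_dvd_sub L _ (prod_pos fun i _ => pow_pos (hpos i) _) x
end
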